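/- Let Λ ⊆ ℝ^{2d} be a countable relatively separated set and v a submultiplicative weight on ℝ^{2d}. If A, B ∈ C_v(Λ), then the matrix product AB is well defined and belongs to C_v(Λ), and there is a constant C (depending only on Λ and v) such that ‖AB‖_{C_v} ≤ C ‖A‖_{C_v} ‖B‖_{C_v}; in particular C_v(Λ) is a Banach algebra (under an equivalent norm). -/

import Mathlib

open MeasureTheory Filter

noncomputable section

abbrev Ed (d : ℕ) := EuclideanSpace ℝ (Fin d)
abbrev E2 (d : ℕ) := EuclideanSpace ℝ (Fin d ⊕ Fin d)

def timePart {d : ℕ} (z : E2 d) : Ed d := WithLp.toLp 2 (fun i => z (Sum.inl i))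
def freqPart {d : ℕ} (z : E2 d) : Ed d := WithLp.toLp 2 (fun i => z (Sum.inr i))

def tfShift {d : ℕ} (z : E2 d) (g : Ed d → ℂ) : Ed d → ℂ :=
  fun t => Complex.exp (2 * Real.pi * Complex.I *
      (∑ i : Fin d, (freqPart z i : ℂ) * (t i : ℂ))) * g (t - timePart z)

def L2inner {d : ℕ} (f h : Ed d → ℂ) : ℂ :=
  ∫ t : Ed d, f t * (starRingEnd ℂ) (h t)

def L2normSq {d : ℕ} (f : Ed d → ℂ) : ℝ := ∫ t : Ed d, ‖f t‖ ^ 2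

def gaussian (d : ℕ) : Ed d → ℂ := fun t => (Real.exp (-Real.pi * ‖t‖ ^ 2) : ℝ)

/-- A (positive, submultiplicative) weight function. -/
structure IsWeight {d : ℕ} (v : E2 d → ℝ) : Prop where
  pos : ∀ z, 0 < v z
  submul : ∀ z w, v (z + w) ≤ v z * v w

/-- The Gelfand–Raikov–Shilov condition `lim_n v(nz)^{1/n} = 1`. -/
def SatisfiesGRS {d : ℕ} (v : E2 d → ℝ) : Prop :=
  ∀ z : E2 d, Tendsto (fun n : ℕ => Real.rpow (v ((n : ℝ) • z)) ((n : ℝ)⁻¹)) atTop (nhds 1)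

/-- Subconvolutivity: `(v⁻¹ * v⁻¹)(z) ≤ C v(z)⁻¹`. -/
def Subconvolutive {d : ℕ} (v : E2 d → ℝ) : Prop :=
  ∃ C > 0, ∀ z : E2 d,
    (∫⁻ w : E2 d, ENNReal.ofReal ((v w)⁻¹ * (v (z - w))⁻¹)) ≤ ENNReal.ofReal (C * (v z)⁻¹)

/-- A set is relatively separated if balls of radius 1 contain boundedly many points. -/
def RelativelySeparated {d : ℕ} (Λ : Set (E2 d)) : Prop :=
  ∃ N : ℕ, ∀ z : E2 d, ({l ∈ Λ | dist l z ≤ 1}).encard ≤ (N : ℕ∞)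

/-- The Gabor frame inequalities with frame bounds `A, B`. -/
def GaborFrame {d : ℕ} (g : Ed d → ℂ) (Λ : Set (E2 d)) (A B : ℝ) : Prop :=
  0 < A ∧ 0 < B ∧ ∀ f : Ed d → ℂ, MemLp f 2 (volume : Measure (Ed d)) →
    A * L2normSq f ≤ (∑' l : Λ, ‖L2inner f (tfShift (l : E2 d) g)‖ ^ 2) ∧
    (∑' l : Λ, ‖L2inner f (tfShift (l : E2 d) g)‖ ^ 2) ≤ B * L2normSq f

/-- The Bessel inequality with Bessel bound `B`. -/
def GaborBessel {d : ℕ} (g : Ed d → ℂ) (Λ : Set (E2 d)) (B : ℝ) : Prop :=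
  ∀ f : Ed d → ℂ, MemLp f 2 (volume : Measure (Ed d)) →
    (∑' l : Λ, ‖L2inner f (tfShift (l : E2 d) g)‖ ^ 2) ≤ B * L2normSq f

/-- `c` lies in the kernel of the synthesis operator `D_{g,Λ}`:  the partial sums
`∑_{λ ∈ s} c_λ π(λ) g` tend to `0` in `L²`. -/
def InSynthKernel {d : ℕ} (g : Ed d → ℂ) (Λ : Set (E2 d)) (c : Λ → ℂ) : Prop :=
  Tendsto (fun s : Finset Λ => ∫ t : Ed d, ‖∑ l ∈ s, c l * tfShift (l : E2 d) g t‖ ^ 2)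
    atTop (nhds 0)

/-- A Gabor system is a Riesz basis if it is a frame and the synthesis operator has
trivial kernel on `ℓ²(Λ)`. -/
def GaborRieszBasis {d : ℕ} (g : Ed d → ℂ) (Λ : Set (E2 d)) : Prop :=
  (∃ A B : ℝ, GaborFrame g Λ A B) ∧
  ∀ c : Λ → ℂ, Summable (fun l : Λ => ‖c l‖ ^ 2) → InSynthKernel g Λ c → ∀ l, c l = 0

/-- The lower Riesz bound `A_n` of the finite section `G(g, Λ ∩ B_n(0))`. -/
def lowerRiesz {d : ℕ} (g : Ed d → ℂ) (Λ : Set (E2 d)) (n : ℕ) : ℝ :=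
  sInf { r : ℝ | ∃ (s : Finset Λ) (c : Λ → ℂ),
    (∀ l ∈ s, ‖(l : E2 d)‖ ≤ (n : ℝ)) ∧
    0 < (∑ l ∈ s, ‖c l‖ ^ 2) ∧
    r = (∫ t : Ed d, ‖∑ l ∈ s, c l * tfShift (l : E2 d) g t‖ ^ 2) / (∑ l ∈ s, ‖c l‖ ^ 2) }

/-- Membership of `g` in the modulation space `M¹_v`. -/
def MemM1 {d : ℕ} (g : Ed d → ℂ) (v : E2 d → ℝ) : Prop :=
  ∫⁻ z : E2 d, ENNReal.ofReal (‖L2inner g (tfShift z (gaussian d))‖ * v z) < ⊤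

/-- Membership of `g` in the modulation space `M^∞_v`. -/
def MemMInf {d : ℕ} (g : Ed d → ℂ) (v : E2 d → ℝ) : Prop :=
  ∃ C : ℝ, ∀ z : E2 d, ‖L2inner g (tfShift z (gaussian d))‖ * v z ≤ C

/-- The integer lattice point `k ∈ ℤ^{2d}` as an element of `ℝ^{2d}`. -/
def intVec {d : ℕ} (k : (Fin d ⊕ Fin d) → ℤ) : E2 d := WithLp.toLp 2 (fun i => (k i : ℝ))

def unitCube (d : ℕ) : Set (E2 d) := {z | ∀ i, z i ∈ Set.Icc (0 : ℝ) 1}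

/-- `sup_{z ∈ [0,1]^{2d}} |Θ(k+z)|`. -/
def cubeSup {d : ℕ} {F : Type*} [NormedAddCommGroup F] (Θ : E2 d → F)
    (k : (Fin d ⊕ Fin d) → ℤ) : ℝ :=
  sSup ((fun z => ‖Θ (intVec k + z)‖) '' unitCube d)

/-- Membership in the Wiener amalgam space `W(C, ℓ¹_v)`. -/
def MemAmalgamW {d : ℕ} {F : Type*} [NormedAddCommGroup F] (Θ : E2 d → F)
    (v : E2 d → ℝ) : Prop :=
  Continuous Θ ∧ Summable (fun k : (Fin d ⊕ Fin d) → ℤ => cubeSup Θ k * v (intVec k))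

/-- The norm of the Wiener amalgam space `W(C, ℓ¹_v)`. -/
def amalgamNorm {d : ℕ} {F : Type*} [NormedAddCommGroup F] (Θ : E2 d → F)
    (v : E2 d → ℝ) : ℝ :=
  ∑' k : (Fin d ⊕ Fin d) → ℤ, cubeSup Θ k * v (intVec k)

/-- Convolution-dominated matrices `C_v(Λ)`. -/
def MemCv {d : ℕ} {Λ : Set (E2 d)} (A : Λ → Λ → ℂ) (v : E2 d → ℝ) : Prop :=
  ∃ Θ : E2 d → ℝ, MemAmalgamW Θ v ∧ ∀ l m : Λ, ‖A l m‖ ≤ Θ ((l : E2 d) - (m : E2 d))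

/-- The norm on `C_v(Λ)`. -/
def CvNorm {d : ℕ} {Λ : Set (E2 d)} (A : Λ → Λ → ℂ) (v : E2 d → ℝ) : ℝ :=
  sInf { r : ℝ | ∃ Θ : E2 d → ℝ, MemAmalgamW Θ v ∧
    (∀ l m : Λ, ‖A l m‖ ≤ Θ ((l : E2 d) - (m : E2 d))) ∧ r = amalgamNorm Θ v }

/-- Matrices with off-diagonal decay `v⁻¹` (the class `C_v^∞(Λ)`, Jaffard class). -/
def MemCvInf {d : ℕ} {Λ : Set (E2 d)} (A : Λ → Λ → ℂ) (v : E2 d → ℝ) : Prop :=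
  ∃ C : ℝ, ∀ l m : Λ, ‖A l m‖ * v ((l : E2 d) - (m : E2 d)) ≤ C

/-- The norm on `C_v^∞(Λ)`. -/
def CvInfNorm {d : ℕ} {Λ : Set (E2 d)} (A : Λ → Λ → ℂ) (v : E2 d → ℝ) : ℝ :=
  sSup { r : ℝ | ∃ l m : Λ, r = ‖A l m‖ * v ((l : E2 d) - (m : E2 d)) }

/-- The Gram matrix `(G_{g,Λ})_{λμ} = ⟨π(μ)g, π(λ)g⟩`. -/
def gramMatrix {d : ℕ} (g : Ed d → ℂ) (Λ : Set (E2 d)) : Λ → Λ → ℂ :=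
  fun l m => L2inner (tfShift (m : E2 d) g) (tfShift (l : E2 d) g)

/-- A bounded operator `T` on `ℓ²(Λ)` is represented by the matrix `A`. -/
def Represents {d : ℕ} {Λ : Set (E2 d)}
    (T : lp (fun _ : Λ => ℂ) 2 →L[ℂ] lp (fun _ : Λ => ℂ) 2) (A : Λ → Λ → ℂ) : Prop :=
  ∀ c : lp (fun _ : Λ => ℂ) 2, ∀ l : Λ, (T c : ∀ _ : Λ, ℂ) l = ∑' m : Λ, A l m * (c : ∀ _ : Λ, ℂ) m



/-- The standard basis vector `e_m` of `ℓ²(Λ)`. -/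
def lpSingle {d : ℕ} {Λ : Set (E2 d)} (m : Λ) : lp (fun _ : Λ => ℂ) 2 :=
  haveI := Classical.decEq (↥Λ)
  lp.single 2 m (1 : ℂ)

@[simp] lemma intVec_apply {d : ℕ} (k : (Fin d ⊕ Fin d) → ℤ) (i : Fin d ⊕ Fin d) :
    intVec k i = (k i : ℝ) := rfl

lemma intVec_add {d : ℕ} (k l : (Fin d ⊕ Fin d) → ℤ) :
    intVec (k + l) = intVec k + intVec l := by
  ext i; simp

/-- The coordinatewise integer part of a vector. -/
def floorVec {d : ℕ} (x : E2 d) : (Fin d ⊕ Fin d) → ℤ := fun i => ⌊x i⌋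

lemma sub_floorVec_mem_unitCube {d : ℕ} (x : E2 d) : x - intVec (floorVec x) ∈ unitCube d := by
  intro i
  have h1 := Int.floor_le (x i)
  have h2 := Int.lt_floor_add_one (x i)
  simp only [PiLp.sub_apply, intVec_apply, floorVec, Set.mem_Icc]
  constructor <;> linarith

lemma isCompact_unitCube (d : ℕ) : IsCompact (unitCube d) := by
  have h : IsCompact (Set.univ.pi fun _ : Fin d ⊕ Fin d => Set.Icc (0 : ℝ) 1) :=
    isCompact_univ_pi fun _ => isCompact_Icc
  convert h.image (PiLp.continuous_toLp 2 (fun _ : Fin d ⊕ Fin d => ℝ)) using 1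
  ext z
  constructor
  · intro hz
    exact ⟨z.ofLp, fun i _ => hz i, rfl⟩
  · rintro ⟨w, hw, rfl⟩ i
    exact hw i trivial

lemma cubeSup_nonneg {d : ℕ} {F : Type*} [NormedAddCommGroup F] (Θ : E2 d → F)
    (k : (Fin d ⊕ Fin d) → ℤ) : 0 ≤ cubeSup Θ k := by
  apply Real.sSup_nonneg
  rintro _ ⟨z, -, rfl⟩
  exact norm_nonneg _

lemma norm_le_cubeSup {d : ℕ} {F : Type*} [NormedAddCommGroup F] {Θ : E2 d → F}
    (hΘ : Continuous Θ) (x : E2 d) : ‖Θ x‖ ≤ cubeSup Θ (floorVec x) := by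
  have hbdd : BddAbove ((fun z => ‖Θ (intVec (floorVec x) + z)‖) '' unitCube d) :=
    ((isCompact_unitCube d).image (by fun_prop)).bddAbove
  refine le_csSup hbdd ⟨_, sub_floorVec_mem_unitCube x, ?_⟩
  simp

lemma cubeSup_le {d : ℕ} {F : Type*} [NormedAddCommGroup F] {Θ : E2 d → F}
    {k : (Fin d ⊕ Fin d) → ℤ} {c : ℝ} (h : ∀ z ∈ unitCube d, ‖Θ (intVec k + z)‖ ≤ c) :
    cubeSup Θ k ≤ c := by
  refine csSup_le (Set.Nonempty.image _ ⟨0, fun i => by simp⟩) ?_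
  rintro _ ⟨z, hz, rfl⟩
  exact h z hz

lemma amalgamNorm_nonneg {d : ℕ} {F : Type*} [NormedAddCommGroup F] (Θ : E2 d → F)
    {v : E2 d → ℝ} (hv : IsWeight v) : 0 ≤ amalgamNorm Θ v :=
  tsum_nonneg fun k => mul_nonneg (cubeSup_nonneg Θ k) (hv.pos _).le

/-- A relatively separated set has boundedly many points in the translates of the unit cube. -/
lemma RelativelySeparated.exists_encard_le {d : ℕ} {Λ : Set (E2 d)} (h : RelativelySeparated Λ) :
    ∃ M : ℕ, ∀ x : E2 d, {l ∈ Λ | l - x ∈ unitCube d}.encard ≤ (M : ℕ∞) := by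
  obtain ⟨N, hN⟩ := h
  obtain ⟨t, -, ht, hcov⟩ :=
    (isCompact_unitCube d).finite_cover_balls (zero_lt_one (α := ℝ))
  lift t to Finset (E2 d) using ht
  refine ⟨t.card * N, fun x => ?_⟩
  have hsub : {l ∈ Λ | l - x ∈ unitCube d} ⊆ ⋃ y ∈ t, {l ∈ Λ | dist l (x + y) ≤ 1} := by
    rintro l ⟨hl, hlx⟩
    obtain ⟨y, hy, hly⟩ := Set.mem_iUnion₂.1 (hcov hlx)
    refine Set.mem_iUnion₂.2 ⟨y, hy, hl, ?_⟩
    rw [Metric.mem_ball, dist_eq_norm] at hly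
    rw [dist_eq_norm, ← sub_sub]
    exact hly.le
  calc _ ≤ (⋃ y ∈ t, {l ∈ Λ | dist l (x + y) ≤ 1}).encard := Set.encard_le_encard hsub
    _ ≤ ∑ y ∈ t, {l ∈ Λ | dist l (x + y) ≤ 1}.encard := t.set_encard_biUnion_le _
    _ ≤ ∑ _y ∈ t, (N : ℕ∞) := Finset.sum_le_sum fun y _ => hN _
    _ = _ := by simp

/-- Composing a summable nonnegative function with a map whose fibres have at most `M` elements
increases its sum at most by the factor `M`. -/
lemma summable_comp_of_fiber_le {ι κ : Type*} {g : ι → κ} {M : ℕ}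
    (hg : ∀ j, {i | g i = j}.encard ≤ (M : ℕ∞)) {G : κ → ℝ} (hG : ∀ j, 0 ≤ G j)
    (hs : Summable G) :
    Summable (fun i => G (g i)) ∧ ∑' i, G (g i) ≤ M * ∑' j, G j := by
  classical
  have key : ∀ s : Finset ι, ∑ i ∈ s, G (g i) ≤ M * ∑' j, G j := by
    intro s
    rw [Finset.sum_comp G g]
    calc _ ≤ ∑ j ∈ s.image g, (M : ℝ) * G j := by
          refine Finset.sum_le_sum fun j _ => ?_
          rw [nsmul_eq_mul]
          refine mul_le_mul_of_nonneg_right ?_ (hG j)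
          have h1 : ((s.filter fun i => g i = j : Finset ι) : Set ι).encard ≤ (M : ℕ∞) :=
            (Set.encard_le_encard fun i hi => by simpa using (Finset.mem_filter.1 hi).2).trans
              (hg j)
          rw [Set.encard_coe_eq_coe_finsetCard] at h1
          exact_mod_cast h1
      _ = M * ∑ j ∈ s.image g, G j := by rw [Finset.mul_sum]
      _ ≤ _ := mul_le_mul_of_nonneg_left (hs.sum_le_tsum _ fun j _ => hG j) (Nat.cast_nonneg _)
  have hsum := summable_of_sum_le (fun i => hG (g i)) key
  exact ⟨hsum, hsum.tsum_le_of_sum_le key⟩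

/-- The trapezoidal function that is `1` on `[0, 1]` and vanishes outside `(-1, 2)`. -/
def trapezoid (t : ℝ) : ℝ := max 0 (min 1 (min (1 + t) (2 - t)))

lemma continuous_trapezoid : Continuous trapezoid := by
  unfold trapezoid; fun_prop

lemma trapezoid_nonneg (t : ℝ) : 0 ≤ trapezoid t := le_max_left _ _

lemma trapezoid_le_one (t : ℝ) : trapezoid t ≤ 1 := max_le zero_le_one (min_le_left _ _)

lemma trapezoid_eq_one {t : ℝ} (h : t ∈ Set.Icc (0 : ℝ) 1) : trapezoid t = 1 := by
  have h1 : 1 ≤ min (1 + t) (2 - t) := le_min (by linarith [h.1]) (by linarith [h.2])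
  rw [trapezoid, min_eq_left h1, max_eq_right zero_le_one]

lemma mem_Ioo_of_trapezoid_ne_zero {t : ℝ} (h : trapezoid t ≠ 0) : t ∈ Set.Ioo (-1 : ℝ) 2 := by
  have h1 : 0 < min 1 (min (1 + t) (2 - t)) := by
    by_contra! hc
    exact h (max_eq_left hc)
  have h2 := lt_min_iff.1 (lt_min_iff.1 h1).2
  constructor <;> linarith [h2.1, h2.2]

/-- The continuous function interpolating a function on the lattice by trapezoidal bumps. -/
def latticeEnvelope {d : ℕ} (c : ((Fin d ⊕ Fin d) → ℤ) → ℝ) (x : E2 d) : ℝ :=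
  ∑ᶠ k, c k * ∏ i, trapezoid (x i - k i)

lemma mem_Ioo_of_mul_prod_trapezoid_ne_zero {d : ℕ} {a : ℝ} {x : E2 d}
    {k : (Fin d ⊕ Fin d) → ℤ} (h : a * ∏ i, trapezoid (x i - k i) ≠ 0) (i : Fin d ⊕ Fin d) :
    x i - k i ∈ Set.Ioo (-1 : ℝ) 2 :=
  mem_Ioo_of_trapezoid_ne_zero
    (Finset.prod_ne_zero_iff.1 (right_ne_zero_of_mul h) i (Finset.mem_univ i))

lemma continuous_latticeEnvelope {d : ℕ} (c : ((Fin d ⊕ Fin d) → ℤ) → ℝ) :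
    Continuous (latticeEnvelope c) := by
  refine continuous_finsum (fun k => ?_) fun x => ?_
  · refine continuous_const.mul (continuous_finsetProd _ fun i _ => ?_)
    exact continuous_trapezoid.comp (by fun_prop)
  · refine ⟨Metric.ball x 1, Metric.ball_mem_nhds x one_pos, ?_⟩
    refine (Set.finite_Icc (floorVec x - 3) (floorVec x + 3)).subset ?_
    rintro k ⟨y, hy, hyx⟩
    have hk := mem_Ioo_of_mul_prod_trapezoid_ne_zero hy
    have hd : ∀ i, |y i - x i| < 1 := fun i =>
      (PiLp.norm_apply_le (y - x) i).trans_lt (by simpa [dist_eq_norm] using hyx)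
    constructor <;> intro i <;> have h1 := hk i <;> have h2 := abs_lt.1 (hd i) <;>
      have h3 := Int.floor_le (x i) <;> have h4 := Int.lt_floor_add_one (x i)
    · have : (⌊x i⌋ : ℝ) < k i + 3 := by linarith [h1.2, h2.1]
      have : ⌊x i⌋ < k i + 3 := by exact_mod_cast this
      simp only [floorVec, Pi.sub_apply, Pi.ofNat_apply]; omega
    · have : (k i : ℝ) < ⌊x i⌋ + 3 := by linarith [h1.1, h2.2]
      have : k i < ⌊x i⌋ + 3 := by exact_mod_cast this
      simp only [floorVec, Pi.add_apply, Pi.ofNat_apply]; omega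

lemma latticeEnvelope_eq_sum {d : ℕ} (c : ((Fin d ⊕ Fin d) → ℤ) → ℝ)
    (p : (Fin d ⊕ Fin d) → ℤ) {z : E2 d} (hz : z ∈ unitCube d) :
    latticeEnvelope c (intVec p + z) =
      ∑ e ∈ Finset.Icc (-1) 1, c (p + e) * ∏ i, trapezoid ((intVec p + z) i - (p + e) i) := by
  rw [latticeEnvelope, finsum_eq_sum_of_support_subset
    (s := (Finset.Icc (-1) 1).map (addLeftEmbedding p)), Finset.sum_map]
  · rfl
  · intro k hk
    have hk := mem_Ioo_of_mul_prod_trapezoid_ne_zero hk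
    refine Finset.mem_coe.2 (Finset.mem_map.2 ⟨k - p, Finset.mem_Icc.2 ⟨?_, ?_⟩, ?_⟩)
    · intro i
      have h1 := (hk i).2
      have h2 := (hz i).1
      simp only [PiLp.add_apply, intVec_apply] at h1
      have : (p i : ℝ) < k i + 2 := by linarith
      have : p i < k i + 2 := by exact_mod_cast this
      simp only [Pi.neg_apply, Pi.one_apply, Pi.sub_apply]; omega
    · intro i
      have h1 := (hk i).1
      have h2 := (hz i).2
      simp only [PiLp.add_apply, intVec_apply] at h1
      have : (k i : ℝ) < p i + 2 := by linarith
      have : k i < p i + 2 := by exact_mod_cast this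
      simp only [Pi.one_apply, Pi.sub_apply]; omega
    · simp

lemma le_latticeEnvelope {d : ℕ} {c : ((Fin d ⊕ Fin d) → ℤ) → ℝ} (hc : ∀ k, 0 ≤ c k)
    (x : E2 d) : c (floorVec x) ≤ latticeEnvelope c x := by
  have hz := sub_floorVec_mem_unitCube x
  have h := latticeEnvelope_eq_sum c (floorVec x) hz
  rw [add_sub_cancel] at h
  rw [h]
  have h0 : (0 : (Fin d ⊕ Fin d) → ℤ) ∈ Finset.Icc (-1) 1 :=
    Finset.mem_Icc.2 ⟨fun i => by simp, fun i => by simp⟩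
  refine le_trans (le_of_eq ?_) (Finset.single_le_sum (fun e _ => mul_nonneg (hc _)
    (Finset.prod_nonneg fun i _ => trapezoid_nonneg _)) h0)
  rw [add_zero, Finset.prod_eq_one, mul_one]
  exact fun i _ => trapezoid_eq_one (hz i)

lemma cubeSup_latticeEnvelope_le {d : ℕ} {c : ((Fin d ⊕ Fin d) → ℤ) → ℝ} (hc : ∀ k, 0 ≤ c k)
    (p : (Fin d ⊕ Fin d) → ℤ) :
    cubeSup (latticeEnvelope c) p ≤ ∑ e ∈ Finset.Icc (-1) 1, c (p + e) := by
  refine cubeSup_le fun z hz => ?_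
  rw [latticeEnvelope_eq_sum c p hz, Real.norm_of_nonneg (Finset.sum_nonneg fun e _ =>
    mul_nonneg (hc _) (Finset.prod_nonneg fun i _ => trapezoid_nonneg _))]
  exact Finset.sum_le_sum fun e _ => mul_le_of_le_one_right (hc _)
    (Finset.prod_le_one (fun i _ => trapezoid_nonneg _) fun i _ => trapezoid_le_one _)

/-- The envelope of a weighted summable lattice function lies in the Wiener amalgam space. -/
lemma memAmalgamW_latticeEnvelope {d : ℕ} {v : E2 d → ℝ} (hv : IsWeight v)
    {c : ((Fin d ⊕ Fin d) → ℤ) → ℝ} (hc : ∀ k, 0 ≤ c k)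
    (hs : Summable fun k => c k * v (intVec k)) :
    MemAmalgamW (latticeEnvelope c) v ∧ amalgamNorm (latticeEnvelope c) v ≤
      (∑ e ∈ Finset.Icc (-1 : (Fin d ⊕ Fin d) → ℤ) 1, v (intVec (-e))) *
        ∑' k, c k * v (intVec k) := by
  set f : ((Fin d ⊕ Fin d) → ℤ) → ℝ := fun k => c k * v (intVec k) with hf
  have hle : ∀ k, cubeSup (latticeEnvelope c) k * v (intVec k) ≤
      ∑ e ∈ Finset.Icc (-1) 1, v (intVec (-e)) * f (k + e) := by
    intro k
    refine (mul_le_mul_of_nonneg_right (cubeSup_latticeEnvelope_le hc k) (hv.pos _).le).trans ?_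
    rw [Finset.sum_mul]
    refine Finset.sum_le_sum fun e _ => ?_
    have h1 : v (intVec k) ≤ v (intVec (k + e)) * v (intVec (-e)) := by
      have h2 := hv.submul (intVec (k + e)) (intVec (-e))
      rwa [← intVec_add, add_neg_cancel_right] at h2
    calc c (k + e) * v (intVec k) ≤ c (k + e) * (v (intVec (k + e)) * v (intVec (-e))) :=
          mul_le_mul_of_nonneg_left h1 (hc _)
      _ = _ := by simp only [hf]; ring
  have hshift : ∀ e, HasSum (fun k => v (intVec (-e)) * f (k + e))
      (v (intVec (-e)) * ∑' k, f k) := fun e =>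
    ((Equiv.addRight e).hasSum_iff.2 hs.hasSum).mul_left _
  have hsum := hasSum_sum fun e (_ : e ∈ Finset.Icc (-1 : (Fin d ⊕ Fin d) → ℤ) 1) => hshift e
  have hsummable := Summable.of_nonneg_of_le
    (fun k => mul_nonneg (cubeSup_nonneg (latticeEnvelope c) k) (hv.pos (intVec k)).le) hle
    hsum.summable
  refine ⟨⟨continuous_latticeEnvelope c, hsummable⟩, ?_⟩
  rw [Finset.sum_mul, ← hsum.tsum_eq]
  exact hsummable.tsum_le_tsum hle hsum.summable

/-- The shifted convolution of two nonnegative summable functions on an additive group. -/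
lemma hasSum_convolution_shift {G : Type*} [AddCommGroup G] {f g : G → ℝ} (hf0 : ∀ k, 0 ≤ f k)
    (hg0 : ∀ k, 0 ≤ g k) (hf : Summable f) (hg : Summable g) (e : G) :
    (∀ p, Summable fun j => f (p - j - e) * g j) ∧
      HasSum (fun p => ∑' j, f (p - j - e) * g j) ((∑' k, f k) * ∑' k, g k) := by
  have hprod : Summable fun x : G × G => f x.1 * g x.2 := hf.mul_of_nonneg hg hf0 hg0
  have htot : HasSum (fun x : G × G => f x.1 * g x.2) ((∑' k, f k) * ∑' k, g k) := by
    rw [hf.tsum_mul_tsum hg hprod]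
    exact hprod.hasSum
  let E : G × G ≃ G × G :=
    { toFun := fun x => (x.1 - x.2 - e, x.2)
      invFun := fun x => (x.1 + x.2 + e, x.2)
      left_inv := fun x => Prod.ext (by simp only; abel) rfl
      right_inv := fun x => Prod.ext (by simp only; abel) rfl }
  have hE : HasSum (fun x : G × G => f (x.1 - x.2 - e) * g x.2) ((∑' k, f k) * ∑' k, g k) :=
    E.hasSum_iff.2 htot
  exact ⟨fun p => hE.summable.prod_factor p,
    hE.prod_fiberwise fun p => (hE.summable.prod_factor p).hasSum⟩

lemma floorVec_add_sub_mem_Icc {d : ℕ} (x y : E2 d) :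
    floorVec (x + y) - floorVec y - floorVec x ∈
      Finset.Icc (0 : (Fin d ⊕ Fin d) → ℤ) 1 := by
  rw [Finset.mem_Icc]
  constructor <;> intro i
  · have := Int.le_floor_add (x i) (y i)
    simp only [floorVec, Pi.zero_apply, Pi.sub_apply, PiLp.add_apply]; omega
  · have := Int.le_floor_add_floor (x i) (y i)
    simp only [floorVec, Pi.one_apply, Pi.sub_apply, PiLp.add_apply]; omega

/-- The product of two matrices with envelopes `Θ` and `Φ` has an envelope whose norm is controlled
by those of `Θ` and `Φ`. -/
lemma exists_envelope_mul {d : ℕ} {Λ : Set (E2 d)} {v : E2 d → ℝ} (hv : IsWeight v) {M : ℕ}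
    (hM : ∀ x : E2 d, {l ∈ Λ | l - x ∈ unitCube d}.encard ≤ (M : ℕ∞))
    {A B : Λ → Λ → ℂ} {Θ Φ : E2 d → ℝ} (hΘ : MemAmalgamW Θ v) (hΦ : MemAmalgamW Φ v)
    (hA : ∀ l m : Λ, ‖A l m‖ ≤ Θ ((l : E2 d) - (m : E2 d)))
    (hB : ∀ l m : Λ, ‖B l m‖ ≤ Φ ((l : E2 d) - (m : E2 d))) :
    (∀ l m : Λ, Summable (fun k : Λ => A l k * B k m)) ∧
    ∃ Ψ : E2 d → ℝ, MemAmalgamW Ψ v ∧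
      (∀ l m : Λ, ‖∑' k : Λ, A l k * B k m‖ ≤ Ψ ((l : E2 d) - (m : E2 d))) ∧
      amalgamNorm Ψ v ≤
        (∑ e ∈ Finset.Icc (-1 : (Fin d ⊕ Fin d) → ℤ) 1, v (intVec (-e))) *
          (M * ∑ e ∈ Finset.Icc (0 : (Fin d ⊕ Fin d) → ℤ) 1, v (intVec e)) *
          (amalgamNorm Θ v * amalgamNorm Φ v) := by
  set a : ((Fin d ⊕ Fin d) → ℤ) → ℝ := fun k => cubeSup Θ k * v (intVec k) with ha
  set b : ((Fin d ⊕ Fin d) → ℤ) → ℝ := fun k => cubeSup Φ k * v (intVec k) with hb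
  have ha0 : ∀ k, 0 ≤ a k := fun k => mul_nonneg (cubeSup_nonneg Θ k) (hv.pos _).le
  have hb0 : ∀ k, 0 ≤ b k := fun k => mul_nonneg (cubeSup_nonneg Φ k) (hv.pos _).le
  have hconv := hasSum_convolution_shift ha0 hb0 hΘ.2 hΦ.2
  let G : ((Fin d ⊕ Fin d) → ℤ) → ((Fin d ⊕ Fin d) → ℤ) → ℝ := fun p j =>
    (v (intVec p))⁻¹ * ∑ e ∈ Finset.Icc (0 : (Fin d ⊕ Fin d) → ℤ) 1,
      v (intVec e) * (a (p - j - e) * b j)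
  have hG0 : ∀ p j, 0 ≤ G p j := fun p j => mul_nonneg (inv_nonneg.2 (hv.pos _).le)
    (Finset.sum_nonneg fun e _ => mul_nonneg (hv.pos _).le (mul_nonneg (ha0 _) (hb0 _)))
  have hGsum : ∀ p, HasSum (G p) ((v (intVec p))⁻¹ *
      ∑ e ∈ Finset.Icc (0 : (Fin d ⊕ Fin d) → ℤ) 1,
        v (intVec e) * ∑' j, a (p - j - e) * b j) := fun p =>
    (hasSum_sum fun e _ => (((hconv e).1 p).hasSum.mul_left (v (intVec e)))).mul_left _
  let c : ((Fin d ⊕ Fin d) → ℤ) → ℝ := fun p => M * ∑' j, G p j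
  have hc0 : ∀ p, 0 ≤ c p := fun p => mul_nonneg (Nat.cast_nonneg _) (tsum_nonneg (hG0 p))
  have hcv : HasSum (fun p => c p * v (intVec p))
      (M * ∑ e ∈ Finset.Icc (0 : (Fin d ⊕ Fin d) → ℤ) 1,
        v (intVec e) * (amalgamNorm Θ v * amalgamNorm Φ v)) := by
    have h := (hasSum_sum fun e (_ : e ∈ Finset.Icc (0 : (Fin d ⊕ Fin d) → ℤ) 1) =>
      (hconv e).2.mul_left (v (intVec e))).mul_left (M : ℝ)
    refine h.congr_fun fun p => ?_
    simp only [c, (hGsum p).tsum_eq]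
    field_simp [(hv.pos (intVec p)).ne']
  have hterm : ∀ l m k : Λ, ‖A l k * B k m‖ ≤
      G (floorVec ((l : E2 d) - (m : E2 d))) (floorVec ((k : E2 d) - (m : E2 d))) := by
    intro l m k
    set p := floorVec ((l : E2 d) - (m : E2 d)) with hp
    set j := floorVec ((k : E2 d) - (m : E2 d)) with hj
    set q := floorVec ((l : E2 d) - (k : E2 d)) with hq
    have hAq : ‖A l k‖ ≤ cubeSup Θ q :=
      ((hA l k).trans (le_abs_self _)).trans (norm_le_cubeSup hΘ.1 _)
    have hBj : ‖B k m‖ ≤ cubeSup Φ j :=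
      ((hB k m).trans (le_abs_self _)).trans (norm_le_cubeSup hΦ.1 _)
    have he : p - j - q ∈ Finset.Icc (0 : (Fin d ⊕ Fin d) → ℤ) 1 := by
      have h := floorVec_add_sub_mem_Icc ((l : E2 d) - (k : E2 d)) ((k : E2 d) - (m : E2 d))
      rwa [sub_add_sub_cancel] at h
    have hsub : v (intVec p) ≤ v (intVec (p - j - q)) * (v (intVec q) * v (intVec j)) := by
      have h1 := hv.submul (intVec (p - j - q)) (intVec (q + j))
      rw [← intVec_add, show p - j - q + (q + j) = p by abel, intVec_add q j] at h1
      exact h1.trans (mul_le_mul_of_nonneg_left (hv.submul _ _) (hv.pos _).le)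
    have hqe : p - j - (p - j - q) = q := sub_sub_cancel _ _
    rw [norm_mul]
    refine (mul_le_mul hAq hBj (norm_nonneg _) (cubeSup_nonneg _ _)).trans ?_
    rw [le_inv_mul_iff₀ (hv.pos _)]
    refine le_trans ?_ (Finset.single_le_sum (fun e _ =>
      mul_nonneg (hv.pos (intVec e)).le (mul_nonneg (ha0 (p - j - e)) (hb0 j))) he)
    rw [hqe]
    calc v (intVec p) * (cubeSup Θ q * cubeSup Φ j)
        ≤ v (intVec (p - j - q)) * (v (intVec q) * v (intVec j)) *
            (cubeSup Θ q * cubeSup Φ j) :=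
          mul_le_mul_of_nonneg_right hsub (mul_nonneg (cubeSup_nonneg _ _) (cubeSup_nonneg _ _))
      _ = _ := by simp only [ha, hb]; ring
  have hfib : ∀ (m : Λ) (j : (Fin d ⊕ Fin d) → ℤ),
      {k : Λ | floorVec ((k : E2 d) - (m : E2 d)) = j}.encard ≤ (M : ℕ∞) := by
    intro m j
    rw [← Subtype.val_injective.encard_image]
    refine (Set.encard_le_encard ?_).trans (hM (m + intVec j))
    rintro _ ⟨k, rfl, rfl⟩
    refine ⟨k.2, ?_⟩
    rw [← sub_sub]
    exact sub_floorVec_mem_unitCube _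
  have hcomp := fun l m : Λ => summable_comp_of_fiber_le (hfib m)
    (hG0 (floorVec ((l : E2 d) - (m : E2 d)))) (hGsum (floorVec ((l : E2 d) - (m : E2 d)))).summable
  have henv := memAmalgamW_latticeEnvelope hv hc0 hcv.summable
  refine ⟨fun l m => .of_norm_bounded (hcomp l m).1 (hterm l m),
    latticeEnvelope c, henv.1, fun l m => ?_, henv.2.trans_eq ?_⟩
  · exact ((tsum_of_norm_bounded (hcomp l m).1.hasSum (hterm l m)).trans (hcomp l m).2).trans
      (le_latticeEnvelope hc0 _)
  · rw [hcv.tsum_eq, ← Finset.sum_mul]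
    ring

lemma CvNorm_le_amalgamNorm {d : ℕ} {Λ : Set (E2 d)} {v : E2 d → ℝ} (hv : IsWeight v)
    {A : Λ → Λ → ℂ} {Θ : E2 d → ℝ} (hΘ : MemAmalgamW Θ v)
    (hA : ∀ l m : Λ, ‖A l m‖ ≤ Θ ((l : E2 d) - (m : E2 d))) : CvNorm A v ≤ amalgamNorm Θ v := by
  refine csInf_le ⟨0, ?_⟩ ⟨Θ, hΘ, hA, rfl⟩
  rintro _ ⟨Θ', -, -, rfl⟩
  exact amalgamNorm_nonneg Θ' hv

lemma MemCv.exists_seq_tendsto_CvNorm {d : ℕ} {Λ : Set (E2 d)} {v : E2 d → ℝ} {A : Λ → Λ → ℂ}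
    (hA : MemCv A v) (hv : IsWeight v) :
    ∃ Θ : ℕ → E2 d → ℝ, (∀ n, MemAmalgamW (Θ n) v) ∧
      (∀ n, ∀ l m : Λ, ‖A l m‖ ≤ Θ n ((l : E2 d) - (m : E2 d))) ∧
      Tendsto (fun n => amalgamNorm (Θ n) v) atTop (nhds (CvNorm A v)) := by
  obtain ⟨Θ₀, hΘ₀, hAΘ₀⟩ := hA
  have hne : { r : ℝ | ∃ Θ : E2 d → ℝ, MemAmalgamW Θ v ∧
      (∀ l m : Λ, ‖A l m‖ ≤ Θ ((l : E2 d) - (m : E2 d))) ∧ r = amalgamNorm Θ v }.Nonempty :=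
    ⟨_, Θ₀, hΘ₀, hAΘ₀, rfl⟩
  obtain ⟨x, -, hx, hxmem⟩ := exists_seq_tendsto_sInf hne ⟨0, by
    rintro _ ⟨Θ, -, -, rfl⟩
    exact amalgamNorm_nonneg Θ hv⟩
  choose Θ hΘ hAΘ hxΘ using hxmem
  exact ⟨Θ, hΘ, hAΘ, hx.congr hxΘ⟩

/-- **`C_v(Λ)` is a Banach algebra:** products of convolution-dominated matrices are well
defined and convolution-dominated, with a submultiplicative norm estimate. -/
theorem Cv_banach_algebra {d : ℕ} (Λ : Set (E2 d)) (hΛc : Λ.Countable)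
    (hΛs : RelativelySeparated Λ) (v : E2 d → ℝ) (hv : IsWeight v) :
    ∃ C : ℝ, 0 < C ∧ ∀ A B : Λ → Λ → ℂ, MemCv A v → MemCv B v →
      (∀ l m : Λ, Summable (fun k : Λ => A l k * B k m)) ∧
      MemCv (fun l m : Λ => ∑' k : Λ, A l k * B k m) v ∧
      CvNorm (fun l m : Λ => ∑' k : Λ, A l k * B k m) v ≤ C * CvNorm A v * CvNorm B v := by
  obtain ⟨M, hM⟩ := hΛs.exists_encard_le
  set K : ℝ := (∑ e ∈ Finset.Icc (-1 : (Fin d ⊕ Fin d) → ℤ) 1, v (intVec (-e))) *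
    (M * ∑ e ∈ Finset.Icc (0 : (Fin d ⊕ Fin d) → ℤ) 1, v (intVec e)) with hK
  have hK0 : 0 ≤ K := mul_nonneg (Finset.sum_nonneg fun e _ => (hv.pos _).le)
    (mul_nonneg (Nat.cast_nonneg _) (Finset.sum_nonneg fun e _ => (hv.pos _).le))
  refine ⟨K + 1, by linarith, fun A B hA hB => ?_⟩
  obtain ⟨Θ, hΘ, hAΘ, hx⟩ := hA.exists_seq_tendsto_CvNorm hv
  obtain ⟨Φ, hΦ, hBΦ, hy⟩ := hB.exists_seq_tendsto_CvNorm hv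
  have hmul := fun n => exists_envelope_mul hv hM (hΘ n) (hΦ n) (hAΘ n) (hBΦ n)
  obtain ⟨hsum, Ψ₀, hΨ₀, hABΨ₀, -⟩ := hmul 0
  refine ⟨hsum, ⟨Ψ₀, hΨ₀, hABΨ₀⟩, ge_of_tendsto' ((hx.const_mul (K + 1)).mul hy) fun n => ?_⟩
  obtain ⟨-, Ψ, hΨ, hABΨ, hle⟩ := hmul n
  rw [mul_assoc]
  refine (CvNorm_le_amalgamNorm hv hΨ hABΨ).trans (hle.trans ?_)
  exact mul_le_mul_of_nonneg_right (by linarith)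
    (mul_nonneg (amalgamNorm_nonneg _ hv) (amalgamNorm_nonneg _ hv))
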